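/- Let β ∈ (0,1/4] and let H : [0,1] → [H̲,H̄] with 1/α < H̲ ≤ H̄ < 1 satisfy |H(t₁) − H(t₂)| ≤ c_H |t₁ − t₂|^{ρ_H} for all t₁,t₂ ∈ [0,1], where c_H > 0 and H̄ < ρ_H ≤ 1. Then there exists a constant c > 0 (not depending on I and N) such that for every compact interval I ⊆ [0,1] and every integer N ≥ 4 with λ(I) ≥ 4(L+1) N^{−1} (log N)², writing H̲(I) = min_{t ∈ I} H(t), one has ( Σ_{k ∈ ν_N(I)} ‖Φ_α(·, H(k/N))‖_{L^α(ℝ)}^β · |2^{β(H̲(I) − H(k/N))} − 1| · N^{−β H(k/N)} ) / ( Σ_{k ∈ ν_N(I)} ‖Φ_α(·, H(k/N))‖_{L^α(ℝ)}^β · N^{−β H(k/N)} ) ≤ c · min{ (log log N)/(log N), λ(I)^{ρ_H} }. -/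

import Mathlib

open MeasureTheory
open scoped Classical

/-- `(x)_+^κ = x^κ` if `x > 0`, and `0` otherwise. -/
noncomputable def posPow (x κ : ℝ) : ℝ := if 0 < x then x ^ κ else 0

/-- `Φ_α(u,v) = Σ_{l=0}^L a_l (l−u)_+^{v−1/α}` with `a_l = (−1)^{L−l}·(L choose l)`. -/
noncomputable def Phi (α : ℝ) (L : ℕ) (u v : ℝ) : ℝ :=
  ∑ l ∈ Finset.range (L + 1),
    ((-1 : ℝ) ^ (L - l) * (L.choose l : ℝ)) * posPow ((l : ℝ) - u) (v - 1 / α)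

/-- `‖Φ_α(·,v)‖_{L^α(ℝ)} = (∫_ℝ |Φ_α(u,v)|^α du)^{1/α}`. -/
noncomputable def PhiNorm (α : ℝ) (L : ℕ) (v : ℝ) : ℝ :=
  (∫ u : ℝ, |Phi α L u v| ^ α) ^ (1 / α)

open Real Finset

lemma posPow_nonneg (x κ : ℝ) : 0 ≤ posPow x κ := by
  unfold posPow
  split_ifs with h
  · exact rpow_nonneg h.le _
  · exact le_rfl

lemma posPow_of_pos {x : ℝ} (hx : 0 < x) (κ : ℝ) : posPow x κ = x ^ κ := if_pos hx

lemma posPow_of_nonpos {x : ℝ} (hx : x ≤ 0) (κ : ℝ) : posPow x κ = 0 := if_neg hx.not_gt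

lemma posPow_mono {κ x y : ℝ} (hκ : 0 ≤ κ) (hxy : x ≤ y) : posPow x κ ≤ posPow y κ := by
  rcases le_or_gt x 0 with h | h
  · rw [posPow_of_nonpos h]
    exact posPow_nonneg _ _
  · rw [posPow_of_pos h, posPow_of_pos (h.trans_le hxy)]
    exact rpow_le_rpow h.le hxy hκ

lemma measurable_posPow (κ : ℝ) : Measurable fun x => posPow x κ := by
  unfold posPow
  exact Measurable.ite measurableSet_Ioi (by fun_prop) measurable_const

lemma measurable_Phi (α : ℝ) (L : ℕ) (v : ℝ) : Measurable fun u => Phi α L u v := by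
  unfold Phi
  refine Finset.measurable_sum _ fun l _ => Measurable.const_mul ?_ _
  exact (measurable_posPow _).comp (measurable_const.sub measurable_id)

lemma rpow_add_sub_rpow_le {κ x y : ℝ} (hκ0 : 0 ≤ κ) (hκ1 : κ ≤ 1) (hx : 0 < x) (hy : 0 ≤ y) :
    (x + y) ^ κ - x ^ κ ≤ y * x ^ (κ - 1) := by
  have h1 : (1 + y / x) ^ κ ≤ 1 + κ * (y / x) :=
    rpow_one_add_le_one_add_mul_self (by have := div_nonneg hy hx.le; linarith) hκ0 hκ1
  have h2 : (x + y) ^ κ = x ^ κ * (1 + y / x) ^ κ := by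
    rw [← mul_rpow hx.le (by positivity)]
    congr 1
    field_simp
  have h3 : x ^ (κ - 1) = x ^ κ / x := rpow_sub_one hx.ne' κ
  have h4 : κ * (y / x) ≤ y / x := mul_le_of_le_one_left (by positivity) hκ1
  rw [h2, h3]
  have h5 : x ^ κ * (1 + y / x) ^ κ ≤ x ^ κ * (1 + y / x) := by gcongr; linarith
  have h6 : y * (x ^ κ / x) = x ^ κ * (y / x) := by ring
  linarith

lemma abs_posPow_sub_posPow_le {κ K : ℝ} (hκ : 0 ≤ κ) (hκK : κ ≤ K) (hK : K ≤ 1) {L l : ℕ}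
    (hL : 1 ≤ L) (hl : l ≤ L) (u : ℝ) :
    |posPow (l - u) κ - posPow (-u) κ| ≤ ((L : ℝ) + 1) ^ 2 * (1 + |u|) ^ (K - 1) := by
  have hl0 : (0 : ℝ) ≤ l := l.cast_nonneg
  have hlL : (l : ℝ) ≤ L := by exact_mod_cast hl
  have hL1 : (1 : ℝ) ≤ L := by exact_mod_cast hL
  have hmono : posPow (-u) κ ≤ posPow (l - u) κ := posPow_mono hκ (by linarith)
  rw [abs_of_nonneg (sub_nonneg.2 hmono)]
  rcases le_or_gt (l : ℝ) u with h | h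
  · rw [posPow_of_nonpos (by linarith), posPow_of_nonpos (by linarith), sub_zero]
    positivity
  rcases le_or_gt (-1) u with h' | h'
  · have h1 : posPow (l - u) κ ≤ (L : ℝ) + 1 := by
      rw [posPow_of_pos (by linarith)]
      calc ((l : ℝ) - u) ^ κ ≤ ((L : ℝ) + 1) ^ κ :=
            rpow_le_rpow (by linarith) (by linarith) hκ
        _ ≤ ((L : ℝ) + 1) ^ (1 : ℝ) := rpow_le_rpow_of_exponent_le (by linarith) (by linarith)
        _ = _ := rpow_one _
    have hu : 1 + |u| ≤ (L : ℝ) + 1 := by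
      have : |u| ≤ L := abs_le.2 ⟨by linarith, by linarith⟩
      linarith
    have h2 : ((L : ℝ) + 1)⁻¹ ≤ (1 + |u|) ^ (K - 1) := by
      calc ((L : ℝ) + 1)⁻¹ ≤ (1 + |u|)⁻¹ := by gcongr
        _ = (1 + |u|) ^ (-1 : ℝ) := (rpow_neg_one _).symm
        _ ≤ _ := rpow_le_rpow_of_exponent_le (by linarith [abs_nonneg u]) (by linarith)
    calc posPow (l - u) κ - posPow (-u) κ ≤ (L : ℝ) + 1 := by
          linarith [posPow_nonneg (-u) κ]
      _ = ((L : ℝ) + 1) ^ 2 * ((L : ℝ) + 1)⁻¹ := by field_simp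
      _ ≤ _ := by gcongr
  · obtain ⟨x, rfl⟩ : ∃ x, u = -x := ⟨-u, by ring⟩
    have hx : 1 < x := by linarith
    have hx0 : 0 < x := by linarith
    rw [abs_neg, abs_of_pos hx0, neg_neg, posPow_of_pos hx0, posPow_of_pos (by linarith),
      show (l : ℝ) - -x = x + l by ring]
    have h1 : x ^ (K - 1) ≤ 2 * (1 + x) ^ (K - 1) := by
      calc x ^ (K - 1) ≤ ((1 + x) / 2) ^ (K - 1) :=
            rpow_le_rpow_of_nonpos (by linarith) (by linarith) (by linarith)
        _ = 2 ^ (1 - K) * (1 + x) ^ (K - 1) := by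
            rw [div_rpow (by linarith) (by norm_num), show (1 - K) = -(K - 1) by ring,
              rpow_neg (by norm_num)]
            ring
        _ ≤ 2 ^ (1 : ℝ) * (1 + x) ^ (K - 1) := by
            gcongr
            · norm_num
            · linarith
        _ = _ := by rw [rpow_one]
    calc (x + l) ^ κ - x ^ κ ≤ l * x ^ (κ - 1) :=
          rpow_add_sub_rpow_le hκ (hκK.trans hK) hx0 hl0
      _ ≤ L * x ^ (K - 1) := by
          gcongr
          exact hx.le
      _ ≤ L * (2 * (1 + x) ^ (K - 1)) := by gcongr
      _ = (2 * L) * (1 + x) ^ (K - 1) := by ring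
      _ ≤ _ := by
          gcongr
          nlinarith

lemma sum_neg_one_pow_mul_choose {L : ℕ} (hL : 1 ≤ L) :
    ∑ l ∈ range (L + 1), ((-1 : ℝ) ^ (L - l) * (L.choose l : ℝ)) = 0 := by
  have h := add_pow (1 : ℝ) (-1) L
  rw [add_neg_cancel, zero_pow (by omega)] at h
  simpa using h.symm

lemma abs_Phi_le {α v K : ℝ} (hκ : 0 ≤ v - 1 / α) (hκK : v - 1 / α ≤ K) (hK : K ≤ 1) {L : ℕ}
    (hL : 1 ≤ L) (u : ℝ) :
    |Phi α L u v| ≤ 2 ^ L * (((L : ℝ) + 1) ^ 2 * (1 + |u|) ^ (K - 1)) := by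
  have h1 : Phi α L u v = ∑ l ∈ range (L + 1), ((-1 : ℝ) ^ (L - l) * (L.choose l : ℝ)) *
      (posPow ((l : ℝ) - u) (v - 1 / α) - posPow (-u) (v - 1 / α)) := by
    simp_rw [mul_sub]
    rw [sum_sub_distrib, ← sum_mul, sum_neg_one_pow_mul_choose hL, zero_mul, sub_zero, Phi]
  have h2 : ∑ l ∈ range (L + 1), (L.choose l : ℝ) = 2 ^ L := by
    exact_mod_cast Nat.sum_range_choose L
  rw [h1, ← h2, sum_mul]
  refine (abs_sum_le_sum_abs _ _).trans (sum_le_sum fun l hl => ?_)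
  rw [abs_mul, abs_mul, abs_pow, abs_neg, abs_one, one_pow, one_mul, Nat.abs_cast]
  gcongr
  exact abs_posPow_sub_posPow_le hκ hκK hK hL (by simpa [Nat.lt_succ_iff] using hl) u

lemma Phi_of_mem {α v u : ℝ} {L : ℕ} (hu : u ∈ Set.Ico ((L : ℝ) - 1) L) :
    Phi α L u v = ((L : ℝ) - u) ^ (v - 1 / α) := by
  unfold Phi
  rw [sum_range_succ, sum_eq_zero, posPow_of_pos (by linarith [hu.2])]
  · simp
  · intro l hl
    have : (l : ℝ) + 1 ≤ L := by exact_mod_cast mem_range.1 hl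
    rw [posPow_of_nonpos (by linarith [hu.1]), mul_zero]

lemma abs_Phi_rpow_le {α v Hup : ℝ} (hα : 1 < α) (hv0 : 1 / α ≤ v) (hv1 : v ≤ Hup)
    (hup : Hup < 1) {L : ℕ} (hL : 1 ≤ L) (u : ℝ) :
    |Phi α L u v| ^ α ≤
      (2 ^ L * ((L : ℝ) + 1) ^ 2) ^ α * (1 + ‖u‖) ^ (-(1 + α * (1 - Hup))) := by
  have hα0 : 0 < α := by linarith
  have h := abs_Phi_le (α := α) (v := v) (K := Hup - 1 / α) (by linarith) (by linarith)
    (by have : 0 < 1 / α := by positivity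
        linarith) hL u
  calc |Phi α L u v| ^ α
      ≤ (2 ^ L * (((L : ℝ) + 1) ^ 2 * (1 + |u|) ^ (Hup - 1 / α - 1))) ^ α :=
        rpow_le_rpow (abs_nonneg _) h hα0.le
    _ = _ := by
        rw [← mul_assoc, mul_rpow (by positivity) (by positivity), ← rpow_mul (by positivity),
          Real.norm_eq_abs]
        congr 2
        field_simp
        ring

lemma integrable_one_add_norm_rpow {α Hup : ℝ} (hα : 1 < α) (hup : Hup < 1) (C : ℝ) :
    Integrable fun u : ℝ => C * (1 + ‖u‖) ^ (-(1 + α * (1 - Hup))) := by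
  refine (integrable_one_add_norm ?_).const_mul C
  have : 0 < α * (1 - Hup) := mul_pos (by linarith) (by linarith)
  simpa using this

lemma integrable_abs_Phi_rpow {α v : ℝ} (hα : 1 < α) (hv0 : 1 / α ≤ v) (hv1 : v < 1)
    {L : ℕ} (hL : 1 ≤ L) : Integrable fun u => |Phi α L u v| ^ α := by
  refine (integrable_one_add_norm_rpow hα hv1 ((2 ^ L * ((L : ℝ) + 1) ^ 2) ^ α)).mono'
    ((measurable_Phi α L v).abs.pow_const α).aestronglyMeasurable
    (Filter.Eventually.of_forall fun u => ?_)
  rw [Real.norm_of_nonneg (by positivity)]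
  exact abs_Phi_rpow_le hα hv0 le_rfl hv1 hL u

lemma le_integral_abs_Phi_rpow {α v : ℝ} (hα : α ∈ Set.Ioo (1 : ℝ) 2) (hv0 : 1 / α ≤ v)
    (hv1 : v < 1) {L : ℕ} (hL : 1 ≤ L) : 1 / 8 ≤ ∫ u : ℝ, |Phi α L u v| ^ α := by
  have hα1 := hα.1
  have hα2 := hα.2
  have h1 : ∫ u : ℝ, (Set.Icc ((L : ℝ) - 1) (L - 1 / 2)).indicator (fun _ => (1 / 4 : ℝ)) u
      = 1 / 8 := by
    rw [integral_indicator measurableSet_Icc, setIntegral_const, Real.volume_real_Icc,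
      max_eq_left (by linarith)]
    norm_num
  rw [← h1]
  refine integral_mono ?_ (integrable_abs_Phi_rpow hα.1 hv0 hv1 hL) fun u => ?_
  · exact (integrableOn_const (by simp)).integrable_indicator measurableSet_Icc
  · by_cases hu : u ∈ Set.Icc ((L : ℝ) - 1) (L - 1 / 2)
    · rw [Set.indicator_of_mem hu]
      have hx : 1 / 2 ≤ (L : ℝ) - u := by linarith [hu.2]
      have : 0 < 1 / α := by positivity
      have h0 : (v - 1 / α) * α ≤ 1 := by
        rw [sub_mul, one_div_mul_cancel (by linarith)]
        nlinarith
      have h0' : 0 ≤ (v - 1 / α) * α := mul_nonneg (by linarith) (by linarith)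
      dsimp only
      rw [Phi_of_mem ⟨hu.1, by linarith⟩, abs_of_nonneg (by positivity),
        ← rpow_mul (by linarith)]
      calc (1 / 4 : ℝ) ≤ (1 / 2) ^ (2 : ℝ) := by norm_num
        _ ≤ (1 / 2) ^ ((v - 1 / α) * α) :=
            rpow_le_rpow_of_exponent_ge (by norm_num) (by norm_num) (by linarith)
        _ ≤ _ := rpow_le_rpow (by norm_num) hx h0'
    · rw [Set.indicator_of_notMem hu]
      positivity

lemma exists_PhiNorm_bounds {α Hup : ℝ} (hα : α ∈ Set.Ioo (1 : ℝ) 2) (hup : Hup < 1) {L : ℕ}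
    (hL : 1 ≤ L) : ∃ m > 0, ∃ M > 0, ∀ v, 1 / α ≤ v → v ≤ Hup →
      m ≤ PhiNorm α L v ∧ PhiNorm α L v ≤ M := by
  have hα1 := hα.1
  set g : ℝ → ℝ := fun u =>
    (2 ^ L * ((L : ℝ) + 1) ^ 2) ^ α * (1 + ‖u‖) ^ (-(1 + α * (1 - Hup))) 
  have hg0 : 0 ≤ ∫ u, g u := integral_nonneg fun u => by positivity
  refine ⟨(1 / 8) ^ (1 / α), by positivity, (1 + ∫ u, g u) ^ (1 / α), by positivity,
    fun v hv0 hv1 => ⟨?_, ?_⟩⟩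
  · exact rpow_le_rpow (by norm_num) (le_integral_abs_Phi_rpow hα hv0 (by linarith) hL)
      (by positivity)
  · refine rpow_le_rpow (integral_nonneg fun u => by positivity) ?_ (by positivity)
    have : ∫ u, |Phi α L u v| ^ α ≤ ∫ u, g u :=
      integral_mono (integrable_abs_Phi_rpow hα.1 hv0 (by linarith) hL)
        (integrable_one_add_norm_rpow hα.1 hup _)
        fun u => abs_Phi_rpow_le hα.1 hv0 hv1 hup hL u
    linarith

lemma card_filter_range_div_mem_Icc_le (n : ℕ) {N : ℕ} (hN : 0 < N) {u w : ℝ} (hu : 0 ≤ u)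
    (huw : u ≤ w) :
    (#((range n).filter fun k : ℕ => (k : ℝ) / N ∈ Set.Icc u w) : ℝ) ≤ N * (w - u) + 1 := by
  have hN' : (0 : ℝ) < N := by exact_mod_cast hN
  have hsub : ((range n).filter fun k : ℕ => (k : ℝ) / N ∈ Set.Icc u w) ⊆ Icc ⌈N * u⌉₊ ⌊N * w⌋₊ := by
    intro k hk
    have hk' := (mem_filter.1 hk).2
    rw [Set.mem_Icc, le_div_iff₀ hN', div_le_iff₀ hN'] at hk'
    rw [Finset.mem_Icc, Nat.ceil_le, Nat.le_floor_iff (mul_nonneg hN'.le (hu.trans huw))]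
    constructor <;> linarith
  have h1 := Nat.floor_le (mul_nonneg hN'.le (hu.trans huw))
  have h2 := Nat.le_ceil (N * u)
  have h3 : (⌊N * w⌋₊ + 1 - ⌈N * u⌉₊ : ℕ) ≤ N * (w - u) + 1 := by
    rcases le_total ⌈N * u⌉₊ (⌊N * w⌋₊ + 1) with h | h
    · rw [Nat.cast_sub h]
      push_cast
      linarith
    · rw [Nat.sub_eq_zero_of_le h]
      have : 0 ≤ N * (w - u) := mul_nonneg hN'.le (by linarith)
      push_cast
      linarith
  refine le_trans ?_ h3
  rw [← Nat.card_Icc]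
  exact_mod_cast card_le_card hsub

lemma le_card_filter_range_div_mem_Icc {N L : ℕ} (hN : 0 < N) {a b : ℝ} (ha : 0 ≤ a)
    (hb : b ≤ 1) (hab : 4 * ((L : ℝ) + 1) ≤ N * (b - a)) :
    N * (b - a) / 2 ≤ #((range (N - L + 1)).filter fun k : ℕ => (k : ℝ) / N ∈ Set.Icc a b) := by
  have hN' : (0 : ℝ) < N := by exact_mod_cast hN
  have hL : (0 : ℝ) ≤ L := L.cast_nonneg
  have hNa : 0 ≤ N * a := by positivity
  have hNb : N * b ≤ N := by nlinarith
  have hLN : L ≤ N := by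
    have : (L : ℝ) ≤ N := by nlinarith
    exact_mod_cast this
  have h0 : 0 ≤ N * b - L := by nlinarith
  have hsub : Icc ⌈N * a⌉₊ ⌊N * b - L⌋₊ ⊆
      (range (N - L + 1)).filter fun k : ℕ => (k : ℝ) / N ∈ Set.Icc a b := by
    intro k hk
    rw [Finset.mem_Icc, Nat.ceil_le, Nat.le_floor_iff h0] at hk
    rw [mem_filter, mem_range, Set.mem_Icc, le_div_iff₀ hN', div_le_iff₀ hN']
    refine ⟨?_, by linarith, by linarith⟩
    have : k + L ≤ N := by
      have : (k : ℝ) + L ≤ N := by linarith [hk.2]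
      exact_mod_cast this
    omega
  have h1 := Nat.lt_floor_add_one (N * b - L)
  have h2 := Nat.ceil_lt_add_one hNa
  have h3 : N * (b - a) / 2 ≤ (⌊N * b - L⌋₊ + 1 - ⌈N * a⌉₊ : ℕ) := by
    have := Nat.cast_le (α := ℝ).2 (le_tsub_add (a := ⌈N * a⌉₊) (b := ⌊N * b - L⌋₊ + 1))
    push_cast at this
    linarith
  refine h3.trans ?_
  rw [← Nat.card_Icc]
  exact_mod_cast card_le_card hsub

lemma abs_two_rpow_sub_one_le {y : ℝ} (hy : y ≤ 0) : |(2 : ℝ) ^ y - 1| ≤ -y := by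
  have h1 : (2 : ℝ) ^ y ≤ 1 := rpow_le_one_of_one_le_of_nonpos (by norm_num) hy
  have h2 : (2 : ℝ) ^ y = exp (log 2 * y) := rpow_def_of_pos (by norm_num) y
  have h3 := add_one_le_exp (log 2 * y)
  have h4 := log_two_lt_d9
  rw [abs_of_nonpos (by linarith), h2]
  nlinarith

lemma abs_two_rpow_sub_one_le_one {y : ℝ} (hy : y ≤ 0) : |(2 : ℝ) ^ y - 1| ≤ 1 := by
  have h1 : (2 : ℝ) ^ y ≤ 1 := rpow_le_one_of_one_le_of_nonpos (by norm_num) hy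
  have h2 : (0 : ℝ) ≤ 2 ^ y := by positivity
  rw [abs_le]
  constructor <;> linarith

lemma one_lt_log_four : 1 < log 4 := by
  rw [lt_log_iff_exp_lt (by norm_num)]
  linarith [exp_one_lt_d9]

lemma abs_two_rpow_sub_one_mul_rpow_le {β h₀ h x : ℝ} (hβ0 : 0 < β) (hβ1 : β ≤ 1)
    (hh : h₀ ≤ h) (hx : 0 < x) (hlog : 1 ≤ log x) :
    |(2 : ℝ) ^ (β * (h₀ - h)) - 1| * x ^ (-(β * h)) ≤
      3 / β * (log (log x) / log x) * x ^ (-(β * h)) + x ^ (-(β * h₀)) / log x ^ 3 := by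
  have hl : 0 < log x := by linarith
  have hll : 0 ≤ log (log x) := log_nonneg hlog
  have hy : β * (h₀ - h) ≤ 0 := mul_nonpos_of_nonneg_of_nonpos hβ0.le (by linarith)
  rcases le_or_gt (h - h₀) (3 / β * (log (log x) / log x)) with hc | hc
  · have h1 : |(2 : ℝ) ^ (β * (h₀ - h)) - 1| ≤ 3 / β * (log (log x) / log x) := by
      refine (abs_two_rpow_sub_one_le hy).trans (le_trans ?_ hc)
      nlinarith
    have h2 : 0 ≤ x ^ (-(β * h₀)) / log x ^ 3 := by positivity
    have := mul_le_mul_of_nonneg_right h1 (rpow_nonneg hx.le (-(β * h)))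
    linarith
  · have h1 : x ^ (-(β * h)) ≤ x ^ (-(β * h₀)) / log x ^ 3 := by
      rw [← exp_log (pow_pos hl 3), rpow_def_of_pos hx, rpow_def_of_pos hx, ← exp_sub,
        exp_le_exp, log_pow]
      have h2 : log x * β * (3 / β * (log (log x) / log x)) ≤ log x * β * (h - h₀) := by gcongr
      have h3 : log x * β * (3 / β * (log (log x) / log x)) = 3 * log (log x) := by
        field_simp
      push_cast
      linarith
    have h2 := mul_le_of_le_one_left (rpow_nonneg hx.le (-(β * h)))
      (abs_two_rpow_sub_one_le_one hy)
    have h3 : 0 ≤ 3 / β * (log (log x) / log x) * x ^ (-(β * h)) := by positivity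
    linarith

lemma exp_neg_mul_rpow_le {β h₀ h x c : ℝ} (hβ0 : 0 < β) (hβ1 : β ≤ 1) (hx : 0 < x)
    (hlog : 0 < log x) (hc : 0 ≤ c) (hh : h - h₀ ≤ c / log x) :
    exp (-c) * x ^ (-(β * h₀)) ≤ x ^ (-(β * h)) := by
  rw [rpow_def_of_pos hx, rpow_def_of_pos hx, ← exp_add, exp_le_exp]
  have h1 : (h - h₀) * log x ≤ c := (le_div_iff₀ hlog).1 hh
  nlinarith

lemma rpow_le_inv_of_le_inv_sq {δ l ρ : ℝ} (hδ : 0 ≤ δ) (hl : 1 ≤ l) (hρ : 1 / 2 ≤ ρ)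
    (h : δ ≤ 1 / l ^ 2) : δ ^ ρ ≤ 1 / l := by
  have hl0 : 0 < l := by linarith
  calc δ ^ ρ ≤ (1 / l ^ 2) ^ ρ := rpow_le_rpow hδ h (by linarith)
    _ ≤ (1 / l ^ 2) ^ (1 / 2 : ℝ) := by
        refine rpow_le_rpow_of_exponent_ge (by positivity) ?_ hρ
        rw [div_le_one (by positivity)]
        exact one_le_pow₀ hl
    _ = 1 / l := by
        rw [← sqrt_eq_rpow, sqrt_div zero_le_one, sqrt_one, sqrt_sq hl0.le]

lemma continuousOn_of_abs_sub_le_rpow {H : ℝ → ℝ} {s : Set ℝ} {c ρ : ℝ} (hρ : 0 < ρ)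
    (h : ∀ t₁ ∈ s, ∀ t₂ ∈ s, |H t₁ - H t₂| ≤ c * |t₁ - t₂| ^ ρ) : ContinuousOn H s := by
  intro t ht
  rw [ContinuousWithinAt, tendsto_iff_dist_tendsto_zero]
  have hcont : Continuous fun x => c * |x - t| ^ ρ :=
    continuous_const.mul ((continuous_id.sub continuous_const).abs.rpow_const
      fun _ => Or.inr hρ.le)
  have hlim : Filter.Tendsto (fun x => c * |x - t| ^ ρ) (nhdsWithin t s) (nhds 0) := by
    have := (hcont.tendsto t).mono_left (nhdsWithin_le_nhds (s := s))
    simpa [zero_rpow hρ.ne'] using this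
  refine squeeze_zero' (Filter.Eventually.of_forall fun _ => dist_nonneg) ?_ hlim
  filter_upwards [self_mem_nhdsWithin] with x hx
  rw [Real.dist_eq]
  exact h x hx t ht

lemma exists_Icc_subinterval {u w t δ : ℝ} (ht : t ∈ Set.Icc u w) (hδ0 : 0 ≤ δ)
    (hδ : δ ≤ w - u) : ∃ a, u ≤ a ∧ a + δ ≤ w ∧ t ∈ Set.Icc a (a + δ) := by
  obtain ⟨h1, h2⟩ := ht
  rcases le_total u (t - δ) with h | h
  · exact ⟨t - δ, h, by linarith, by linarith, by linarith⟩
  · exact ⟨u, le_rfl, by linarith, h1, by linarith⟩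

lemma exists_subset_filter_range_near {N L : ℕ} (hN : 0 < N) {u w t l : ℝ} (hu : 0 ≤ u)
    (hw : w ≤ 1) (ht : t ∈ Set.Icc u w) (hl : 1 ≤ l)
    (h : 4 * ((L : ℝ) + 1) * l ^ 2 / N ≤ w - u) :
    ∃ δ : ℝ, 0 ≤ δ ∧ δ ≤ 1 / l ^ 2 ∧
      ∃ T ⊆ (range (N - L + 1)).filter fun k : ℕ => (k : ℝ) / N ∈ Set.Icc u w,
        (∀ k ∈ T, |(k : ℝ) / N - t| ≤ δ) ∧
        (#((range (N - L + 1)).filter fun k : ℕ => (k : ℝ) / N ∈ Set.Icc u w) : ℝ) ≤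
          4 * l ^ 2 * #T := by
  have hN0 : (0 : ℝ) < N := by exact_mod_cast hN
  have hl0 : 0 < l := by linarith
  have huw : u ≤ w := ht.1.trans ht.2
  obtain ⟨δ, hδ⟩ : ∃ δ, δ = (w - u) / l ^ 2 := ⟨_, rfl⟩
  have hδl : δ * l ^ 2 = w - u := by
    rw [hδ]
    field_simp
  have hδ0 : 0 ≤ δ := hδ ▸ div_nonneg (by linarith) (by positivity)
  have hδw : δ ≤ w - u := hδ ▸ div_le_self (by linarith) (one_le_pow₀ hl)
  have hNδ : 4 * ((L : ℝ) + 1) ≤ N * δ := by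
    rw [div_le_iff₀ hN0, ← hδl] at h
    have : 4 * ((L : ℝ) + 1) * l ^ 2 ≤ (N * δ) * l ^ 2 := by linarith
    exact le_of_mul_le_mul_right this (by positivity)
  obtain ⟨a, hua, haw, hta⟩ := exists_Icc_subinterval ht hδ0 hδw
  refine ⟨δ, hδ0, ?_, (range (N - L + 1)).filter fun k : ℕ => (k : ℝ) / N ∈ Set.Icc a (a + δ),
    ?_, ?_, ?_⟩
  · rw [hδ]
    gcongr
    linarith
  · exact monotone_filter_right _ fun k _ hk => Set.Icc_subset_Icc hua haw hk
  · intro k hk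
    have hk' := (mem_filter.1 hk).2
    exact abs_le.2 ⟨by linarith [hk'.1, hta.2], by linarith [hk'.2, hta.1]⟩
  · have h1 := le_card_filter_range_div_mem_Icc (N := N) (L := L) (a := a) (b := a + δ)
      hN (by linarith) (by linarith) (by rwa [add_sub_cancel_left])
    rw [add_sub_cancel_left] at h1
    have h2 := card_filter_range_div_mem_Icc_le (N - L + 1) hN hu huw
    have h3 := mul_le_mul_of_nonneg_left h1 (show 0 ≤ 4 * l ^ 2 by positivity)
    have h4 : 4 * l ^ 2 * (N * δ / 2) = 2 * (N * (w - u)) := by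
      rw [← hδl]
      ring
    have h5 : N * δ ≤ N * (w - u) := by gcongr
    have h6 : (0 : ℝ) ≤ L := L.cast_nonneg
    linarith

lemma sum_mul_oscillation_le {ι : Type*} {S T : Finset ι} (hTS : T ⊆ S) {p h : ι → ℝ}
    {β h₀ m M l x c : ℝ} (hβ0 : 0 < β) (hβ1 : β ≤ 1) (hm : 0 < m) (hc : 0 ≤ c) (hx : 0 < x)
    (hl : l = log x) (hl1 : 1 ≤ l) (hp : ∀ k ∈ S, m ≤ p k ∧ p k ≤ M) (hh : ∀ k ∈ S, h₀ ≤ h k)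
    (hT : ∀ k ∈ T, h k - h₀ ≤ c / l) (hST : (#S : ℝ) ≤ 4 * l ^ 2 * #T) :
    ∑ k ∈ S, p k * |(2 : ℝ) ^ (β * (h₀ - h k)) - 1| * x ^ (-(β * h k)) ≤
      (3 / β * (log l / l) + 4 * (M / m) * exp c / l) * ∑ k ∈ S, p k * x ^ (-(β * h k)) := by
  subst hl
  have hl0 : 0 < log x := by linarith
  set Q := x ^ (-(β * h₀))
  have hQ0 : 0 < Q := rpow_pos_of_pos hx _
  rcases S.eq_empty_or_nonempty with rfl | ⟨k₀, hk₀⟩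
  · simp
  have hM : 0 < M := hm.trans_le ((hp k₀ hk₀).1.trans (hp k₀ hk₀).2)
  have h1 : ∑ k ∈ S, p k * |(2 : ℝ) ^ (β * (h₀ - h k)) - 1| * x ^ (-(β * h k)) ≤
      3 / β * (log (log x) / log x) * ∑ k ∈ S, p k * x ^ (-(β * h k)) +
        #S * (M * (Q / log x ^ 3)) := by
    rw [mul_sum, ← nsmul_eq_mul, ← sum_const, ← sum_add_distrib]
    refine sum_le_sum fun k hk => ?_
    obtain ⟨hmp, hpM⟩ := hp k hk
    have h2 := mul_le_mul_of_nonneg_left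
      (abs_two_rpow_sub_one_mul_rpow_le hβ0 hβ1 (hh k hk) hx hl1) (hm.le.trans hmp)
    have h3 : p k * (Q / log x ^ 3) ≤ M * (Q / log x ^ 3) := by gcongr
    linarith
  have h4 : #T * (m * (exp (-c) * Q)) ≤ ∑ k ∈ S, p k * x ^ (-(β * h k)) := by
    rw [← nsmul_eq_mul, ← sum_const]
    refine (sum_le_sum fun k hk => ?_).trans (sum_le_sum_of_subset_of_nonneg hTS
      fun k hk _ => mul_nonneg (hm.le.trans (hp k hk).1) (rpow_nonneg hx.le _))
    exact mul_le_mul (hp k (hTS hk)).1 (exp_neg_mul_rpow_le hβ0 hβ1 hx hl0 hc (hT k hk))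
      (by positivity) (hm.le.trans (hp k (hTS hk)).1)
  have h5 : #S * (M * (Q / log x ^ 3)) ≤
      4 * (M / m) * exp c / log x * ∑ k ∈ S, p k * x ^ (-(β * h k)) :=
    calc #S * (M * (Q / log x ^ 3)) ≤ 4 * log x ^ 2 * #T * (M * (Q / log x ^ 3)) := by gcongr
      _ = 4 * (M / m) * exp c / log x * (#T * (m * (exp (-c) * Q))) := by
          rw [exp_neg]
          field_simp
      _ ≤ _ := by gcongr
  rw [add_mul]
  linarith

lemma sum_mul_oscillation_le_of_sub_le {ι : Type*} {S : Finset ι} {p h : ι → ℝ}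
    {β h₀ x d : ℝ} (hβ0 : 0 < β) (hβ1 : β ≤ 1) (hx : 0 < x) (hp : ∀ k ∈ S, 0 ≤ p k)
    (hh : ∀ k ∈ S, h₀ ≤ h k) (hd : ∀ k ∈ S, h k - h₀ ≤ d) :
    ∑ k ∈ S, p k * |(2 : ℝ) ^ (β * (h₀ - h k)) - 1| * x ^ (-(β * h k)) ≤
      d * ∑ k ∈ S, p k * x ^ (-(β * h k)) := by
  rw [mul_sum]
  refine sum_le_sum fun k hk => ?_
  have h1 := abs_two_rpow_sub_one_le
    (mul_nonpos_of_nonneg_of_nonpos hβ0.le (sub_nonpos.2 (hh k hk)))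
  have h2 : |(2 : ℝ) ^ (β * (h₀ - h k)) - 1| ≤ d := by nlinarith [hh k hk, hd k hk]
  calc p k * |(2 : ℝ) ^ (β * (h₀ - h k)) - 1| * x ^ (-(β * h k))
      ≤ p k * d * x ^ (-(β * h k)) := by
        have := hp k hk
        gcongr
    _ = _ := by ring

/-- There is `c > 0` (not depending on `I` and `N`) such that for
every compact interval `I = [u,w] ⊆ [0,1]` and every `N ≥ 4` with
`λ(I) ≥ 4(L+1)N^{−1}(log N)²`, writing `H̲(I) = min_{t∈I} H(t)`,
`(Σ_{k∈ν_N(I)} ‖Φ_α(·,H(k/N))‖^β·|2^{β(H̲(I)−H(k/N))}−1|·N^{−βH(k/N)})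
 / (Σ_{k∈ν_N(I)} ‖Φ_α(·,H(k/N))‖^β·N^{−βH(k/N)})
  ≤ c·min{(log log N)/(log N), λ(I)^{ρ_H}}`. -/
theorem weighted_oscillation_ratio_bound (α : ℝ)
    (hα : α ∈ Set.Ioo (1 : ℝ) 2) (L : ℕ) (hL : 2 ≤ L) (β : ℝ)
    (hβ : β ∈ Set.Ioc (0 : ℝ) (1 / 4)) (Hlow Hup : ℝ) (h0 : 1 / α < Hlow)
    (h1 : Hlow ≤ Hup) (h2 : Hup < 1) (H : ℝ → ℝ)
    (hH : ∀ t ∈ Set.Icc (0 : ℝ) 1, H t ∈ Set.Icc Hlow Hup) (cH ρ : ℝ)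
    (hcH : 0 < cH) (hρ0 : Hup < ρ) (hρ1 : ρ ≤ 1)
    (hHol : ∀ t₁ ∈ Set.Icc (0 : ℝ) 1, ∀ t₂ ∈ Set.Icc (0 : ℝ) 1,
      |H t₁ - H t₂| ≤ cH * |t₁ - t₂| ^ ρ) :
    ∃ c > (0 : ℝ), ∀ u w : ℝ, 0 ≤ u → u < w → w ≤ 1 → ∀ N : ℕ, 4 ≤ N →
      4 * ((L : ℝ) + 1) * (Real.log N) ^ 2 / N ≤ w - u →
      let ν : Finset ℕ :=
        (Finset.range (N - L + 1)).filter fun k => (k : ℝ) / N ∈ Set.Icc u w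
      let HI := sInf (H '' Set.Icc u w)
      (∑ k ∈ ν, PhiNorm α L (H ((k : ℝ) / N)) ^ β *
          |(2 : ℝ) ^ (β * (HI - H ((k : ℝ) / N))) - 1| *
          (N : ℝ) ^ (-(β * H ((k : ℝ) / N)))) /
        (∑ k ∈ ν, PhiNorm α L (H ((k : ℝ) / N)) ^ β *
          (N : ℝ) ^ (-(β * H ((k : ℝ) / N)))) ≤
      c * min (Real.log (Real.log N) / Real.log N) ((w - u) ^ ρ) := by
  have hα1 := hα.1
  obtain ⟨hβ0, hβ4⟩ := hβ
  have hβ1 : β ≤ 1 := by linarith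
  have hρ : 1 / 2 ≤ ρ := by
    have : 1 / 2 ≤ 1 / α := one_div_le_one_div_of_le (by linarith) hα.2.le
    linarith
  obtain ⟨m, hm, M, hM, hPhi⟩ := exists_PhiNorm_bounds hα h2 (show 1 ≤ L by omega)
  set B := 4 * (M ^ β / m ^ β) * exp cH
  have hB0 : 0 < B := by positivity
  have hll4 : 0 < log (log 4) := log_pos one_lt_log_four
  refine ⟨cH + 3 / β + B / log (log 4), by positivity, fun u w hu huw hw N hN hNuw => ?_⟩
  intro ν HI
  have hN4 : (4 : ℝ) ≤ N := by exact_mod_cast hN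
  have hN0 : (0 : ℝ) < N := by linarith
  set l := log N with hl
  have hl4 : log 4 ≤ l := log_le_log (by norm_num) hN4
  have hl1 : 1 ≤ l := one_lt_log_four.le.trans hl4
  have hl0 : 0 < l := by linarith
  have hll : log (log 4) ≤ log l := log_le_log (by linarith [one_lt_log_four]) hl4
  have hsub : Set.Icc u w ⊆ Set.Icc 0 1 := Set.Icc_subset_Icc hu hw
  obtain ⟨t, ht, hmin⟩ := isCompact_Icc.exists_isMinOn (Set.nonempty_Icc.2 huw.le)
    ((continuousOn_of_abs_sub_le_rpow (by linarith) hHol).mono hsub)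
  have hHI : HI = H t := IsLeast.csInf_eq ⟨Set.mem_image_of_mem _ ht, by
    rintro _ ⟨s, hs, rfl⟩
    exact hmin hs⟩
  have hosc : ∀ s ∈ Set.Icc u w, ∀ δ, |s - t| ≤ δ → H s - HI ≤ cH * δ ^ ρ := by
    intro s hs δ hδ
    rw [hHI]
    refine (le_abs_self _).trans ((hHol s (hsub hs) t (hsub ht)).trans ?_)
    gcongr
  have hmem : ∀ k ∈ ν, (k : ℝ) / N ∈ Set.Icc u w := fun k hk => (mem_filter.1 hk).2
  have hlow : ∀ k ∈ ν, HI ≤ H ((k : ℝ) / N) := fun k hk => hHI ▸ hmin (hmem k hk)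
  have hp : ∀ k ∈ ν, m ^ β ≤ PhiNorm α L (H ((k : ℝ) / N)) ^ β ∧
      PhiNorm α L (H ((k : ℝ) / N)) ^ β ≤ M ^ β := by
    intro k hk
    obtain ⟨hH1, hH2⟩ := hH _ (hsub (hmem k hk))
    obtain ⟨hP1, hP2⟩ := hPhi _ (h0.le.trans hH1) hH2
    exact ⟨rpow_le_rpow hm.le hP1 hβ0.le, rpow_le_rpow (hm.le.trans hP1) hP2 hβ0.le⟩
  have hp0 : ∀ k ∈ ν, 0 ≤ PhiNorm α L (H ((k : ℝ) / N)) ^ β := fun k hk =>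
    (rpow_pos_of_pos hm β).le.trans (hp k hk).1
  set D := ∑ k ∈ ν, PhiNorm α L (H ((k : ℝ) / N)) ^ β * (N : ℝ) ^ (-(β * H ((k : ℝ) / N)))
    with hD
  have hD0 : 0 ≤ D := sum_nonneg fun k hk => mul_nonneg (hp0 k hk) (rpow_nonneg hN0.le _)
  have hlll : 0 ≤ log l / l := div_nonneg (by linarith) hl0.le
  refine div_le_of_le_mul₀ hD0 (by positivity) ?_
  rw [mul_min_of_nonneg _ _ (by positivity), min_mul_of_nonneg _ _ hD0]
  refine le_min ?_ ?_
  · obtain ⟨δ, hδ0, hδl, T, hTν, hTδ, hνcard⟩ :=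
      exists_subset_filter_range_near (by omega) hu hw ht hl1 hNuw
    have hT : ∀ k ∈ T, H ((k : ℝ) / N) - HI ≤ cH / l := by
      intro k hk
      refine (hosc _ (hmem k (hTν hk)) δ (hTδ k hk)).trans ?_
      rw [div_eq_mul_one_div]
      gcongr
      exact rpow_le_inv_of_le_inv_sq hδ0 hl1 hρ hδl
    refine (sum_mul_oscillation_le hTν hβ0 hβ1 (rpow_pos_of_pos hm β) hcH.le hN0
      hl hl1 hp hlow hT hνcard).trans ?_
    refine mul_le_mul_of_nonneg_right ?_ hD0
    have h3 : B / l ≤ B / log (log 4) * (log l / l) := by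
      rw [div_mul_div_comm, div_le_div_iff₀ hl0 (by positivity)]
      have : B * log (log 4) * l ≤ B * log l * l := by gcongr
      linarith
    have h4 : 0 ≤ cH * (log l / l) := mul_nonneg hcH.le hlll
    linarith
  · refine (sum_mul_oscillation_le_of_sub_le hβ0 hβ1 hN0 hp0 hlow fun k hk =>
      hosc _ (hmem k hk) (w - u) ?_).trans (mul_le_mul_of_nonneg_right ?_ hD0)
    · have := hmem k hk
      exact abs_le.2 ⟨by linarith [this.1, ht.2], by linarith [this.2, ht.1]⟩
    · gcongr
      have : 0 ≤ 3 / β := by positivity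
      have : 0 ≤ B / log (log 4) := by positivity
      linarith
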